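/- Let S=(E,A,B,C,D) be an antistable system of order n with Gramians X_c, X_o and largest Hankel singular value σ₁, and consider the matrices E_{σ₁}, A_{σ₁} built with γ = σ₁. Then the following are equivalent: (i) the pair (E_{σ₁}, A_{σ₁}) is regular; (ii) sE_{σ₁} − A_{σ₁} is invertible for every s ∈ ℂ with Re s ≥ 0 (the generalized spectrum of the pair is contained in {Re s < 0} ∪ {∞}); (iii) the matrix A_{σ₁} is invertible. -/

import Mathlib

open Matrix

noncomputable section

/-- Entrywise complexification of a real matrix. -/
def cplx {ι κ : Type*} (M : Matrix ι κ ℝ) : Matrix ι κ ℂ :=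
  M.map fun x => (x : ℂ)

/-- The matrix pair (E, A) is regular: det(sE − A) ≠ 0 for some s ∈ ℂ. -/
def RegularPair {ι : Type*} [Fintype ι] [DecidableEq ι] (E A : Matrix ι ι ℝ) : Prop :=
  ∃ s : ℂ, (s • cplx E - cplx A).det ≠ 0

/-- (E, A) is stable: sE − A is invertible for every s with Re s ≥ 0. -/
def StablePair {ι : Type*} [Fintype ι] [DecidableEq ι] (E A : Matrix ι ι ℝ) : Prop :=
  ∀ s : ℂ, 0 ≤ s.re → IsUnit (s • cplx E - cplx A)

/-- (E, A) is antistable: E invertible and sE − A invertible for every s with Re s ≤ 0. -/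
def AntistablePair {ι : Type*} [Fintype ι] [DecidableEq ι] (E A : Matrix ι ι ℝ) : Prop :=
  IsUnit E ∧ ∀ s : ℂ, s.re ≤ 0 → IsUnit (s • cplx E - cplx A)

/-- Transfer function G(s) = C (sE − A)⁻¹ B + D of the system (E, A, B, C, D). -/
def transfer {ι κm κp : Type*} [Fintype ι] [DecidableEq ι]
    (E A : Matrix ι ι ℝ) (B : Matrix ι κm ℝ) (C : Matrix κp ι ℝ) (D : Matrix κp κm ℝ)
    (s : ℂ) : Matrix κp κm ℂ :=
  cplx C * (s • cplx E - cplx A)⁻¹ * cplx B + cplx D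

/-- Spectral norm (ℓ² operator norm) of a complex matrix. -/
def spec2 {κp κm : Type*} [Fintype κp] [Fintype κm] [DecidableEq κm]
    (M : Matrix κp κm ℂ) : ℝ :=
  ‖LinearMap.toContinuousLinearMap (Matrix.toEuclideanLin M)‖

/-- Squared Frobenius norm of a complex matrix. -/
def frobSq {κp κm : Type*} [Fintype κp] [Fintype κm] (M : Matrix κp κm ℂ) : ℝ :=
  ∑ i, ∑ j, ‖M i j‖ ^ 2

/-- `Xc`, `Xo` are controllability/observability Gramians of the system (E, A, B, C, ·). -/
def IsGramians {ι κm κp : Type*} [Fintype ι] [Fintype κm] [Fintype κp]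
    (E A : Matrix ι ι ℝ) (B : Matrix ι κm ℝ) (C : Matrix κp ι ℝ)
    (Xc Xo : Matrix ι ι ℝ) : Prop :=
  Xc.IsSymm ∧ Xo.IsSymm ∧
    A * Xc * Eᵀ + E * Xc * Aᵀ + B * Bᵀ = 0 ∧
    Aᵀ * Xo * E + Eᵀ * Xo * A + Cᵀ * C = 0

/-- σ₁ ≥ 0 is the largest Hankel singular value: σ₁² is the greatest eigenvalue of XcEᵀXoE. -/
def IsLargestHSV {ι : Type*} [Fintype ι] [DecidableEq ι]
    (E Xc Xo : Matrix ι ι ℝ) (σ1 : ℝ) : Prop :=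
  0 ≤ σ1 ∧ ((σ1 : ℂ) ^ 2) ∈ spectrum ℂ (cplx (Xc * Eᵀ * Xo * E)) ∧
    ∀ μ ∈ spectrum ℂ (cplx (Xc * Eᵀ * Xo * E)), μ.re ≤ σ1 ^ 2

/-- R_γ = XoEXcEᵀ − γ²I. -/
def Rg {ι : Type*} [Fintype ι] [DecidableEq ι] (E Xc Xo : Matrix ι ι ℝ) (γ : ℝ) :
    Matrix ι ι ℝ :=
  Xo * E * Xc * Eᵀ - γ ^ 2 • (1 : Matrix ι ι ℝ)

/-- E_γ = Eᵀ R_γ. -/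
def Eg {ι : Type*} [Fintype ι] [DecidableEq ι] (E Xc Xo : Matrix ι ι ℝ) (γ : ℝ) :
    Matrix ι ι ℝ :=
  Eᵀ * Rg E Xc Xo γ

/-- C_γ = C Xc Eᵀ. -/
def Cg {ι κp : Type*} [Fintype ι] (C : Matrix κp ι ℝ) (E Xc : Matrix ι ι ℝ) :
    Matrix κp ι ℝ :=
  C * Xc * Eᵀ

/-- A_γ = −Aᵀ R_γ − Cᵀ C_γ. -/
def Ag {ι κp : Type*} [Fintype ι] [Fintype κp] [DecidableEq ι]
    (E A : Matrix ι ι ℝ) (C : Matrix κp ι ℝ) (Xc Xo : Matrix ι ι ℝ) (γ : ℝ) :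
    Matrix ι ι ℝ :=
  -(Aᵀ * Rg E Xc Xo γ) - Cᵀ * Cg C E Xc

/-- B_γ = Eᵀ Xo B. -/
def Bg {ι κm : Type*} [Fintype ι] (E Xo : Matrix ι ι ℝ) (B : Matrix ι κm ℝ) :
    Matrix ι κm ℝ :=
  Eᵀ * Xo * B

/-- The point iω on the imaginary axis. -/
def iax (ω : ℝ) : ℂ := (ω : ℂ) * Complex.I

/-- Canonical equivalence Fin k ⊕ Fin d ≃ Fin n given k + d = n. -/
def finBlockEquiv {k d n : ℕ} (h : k + d = n) : Fin k ⊕ Fin d ≃ Fin n :=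
  finSumFinEquiv.trans (finCongr h)

end

section BanachAlgebra

open Filter Topology
open scoped ENNReal

/-- In a complex Banach algebra, the powers of an element of spectral radius less than one
tend to zero. -/
theorem tendsto_pow_zero_of_spectralRadius_lt_one {𝔸 : Type*} [NormedRing 𝔸] [NormedAlgebra ℂ 𝔸]
    [CompleteSpace 𝔸] {a : 𝔸} (ha : spectralRadius ℂ a < 1) :
    Tendsto (fun k : ℕ => a ^ k) atTop (𝓝 0) := by
  obtain ⟨r, har, hr1⟩ := ENNReal.lt_iff_exists_nnreal_btwn.mp ha
  have hr : r < 1 := by exact_mod_cast hr1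
  have hev := (spectrum.pow_nnnorm_pow_one_div_tendsto_nhds_spectralRadius a).eventually
    (gt_mem_nhds har)
  refine squeeze_zero_norm' (a := fun k : ℕ => (r : ℝ) ^ k) ?_
    (tendsto_pow_atTop_nhds_zero_of_lt_one r.2 hr)
  filter_upwards [hev, eventually_gt_atTop 0] with k hk hk0
  have hkr : (0 : ℝ) < k := by exact_mod_cast hk0
  have h := ENNReal.rpow_le_rpow hk.le hkr.le
  rw [← ENNReal.rpow_mul, one_div, inv_mul_cancel₀ hkr.ne', ENNReal.rpow_one,
    ENNReal.rpow_natCast] at h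
  exact_mod_cast h

end BanachAlgebra

namespace Matrix

open scoped ComplexOrder

variable {ι : Type*} [Fintype ι]

section Norm

open Filter Topology
open scoped Matrix.Norms.L2Operator

variable [DecidableEq ι]

theorem tendsto_pow_zero_of_forall_mem_spectrum {K : Matrix ι ι ℂ}
    (hK : ∀ μ ∈ spectrum ℂ K, ‖μ‖ < 1) : Tendsto (fun k : ℕ => K ^ k) atTop (𝓝 0) := by
  cases isEmpty_or_nonempty ι
  · rw [show (fun k : ℕ => K ^ k) = fun _ => 0 from funext fun k => Subsingleton.elim _ _]
    exact tendsto_const_nhds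
  · refine tendsto_pow_zero_of_spectralRadius_lt_one ?_
    exact_mod_cast spectrum.spectralRadius_lt_of_forall_lt K (r := 1)
      fun μ hμ => by exact_mod_cast hK μ hμ

end Norm

section Order

open scoped MatrixOrder Matrix.Norms.L2Operator

theorem PosSemidef.exists_eq_mul_conjTranspose [DecidableEq ι] {M : Matrix ι ι ℂ}
    (hM : M.PosSemidef) : ∃ L : Matrix ι ι ℂ, M = L * Lᴴ := by
  obtain ⟨L, hL⟩ := CStarAlgebra.nonneg_iff_eq_star_mul_self.mp hM.nonneg
  exact ⟨Lᴴ, by rw [conjTranspose_conjTranspose]; exact hL⟩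

end Order

/-- The solution of a Stein equation with convergent coefficient and positive semidefinite
right-hand side is positive semidefinite. -/
theorem posSemidef_of_sub_mul_mul_conjTranspose [DecidableEq ι] {K Y : Matrix ι ι ℂ}
    (hK : ∀ μ ∈ spectrum ℂ K, ‖μ‖ < 1) (hY : Y.IsHermitian)
    (h : (Y - K * Y * Kᴴ).PosSemidef) : Y.PosSemidef := by
  have hpow : ∀ k : ℕ, (Y - K ^ k * Y * (K ^ k)ᴴ).PosSemidef := by
    intro k
    induction k with
    | zero => simpa using PosSemidef.zero
    | succ k ih =>
      have := h.add (ih.mul_mul_conjTranspose_same K)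
      convert this using 1
      rw [pow_succ' K k, conjTranspose_mul]
      noncomm_ring
  refine .of_dotProduct_mulVec_nonneg hY fun x => ?_
  have hlim := tendsto_pow_zero_of_forall_mem_spectrum hK
  have hcont : Continuous fun M : Matrix ι ι ℂ => star x ⬝ᵥ (Y - M * Y * Mᴴ) *ᵥ x := by fun_prop
  have hlim' := (hcont.tendsto 0).comp hlim
  simp only [zero_mul, sub_zero] at hlim'
  exact ge_of_tendsto' hlim' fun k => (hpow k).dotProduct_mulVec_nonneg x

/-- The Cayley transform of an antistable pencil is convergent. -/
theorem norm_lt_one_of_mem_spectrum_cayley [DecidableEq ι] {E A : Matrix ι ι ℂ}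
    (hE : IsUnit E) (hEA : ∀ s : ℂ, s.re ≤ 0 → IsUnit (s • E - A)) :
    ∀ μ ∈ spectrum ℂ ((A + E)⁻¹ * (A - E)), ‖μ‖ < 1 := by
  have hAE : IsUnit (A + E) := by
    have := (hEA (-1) (by simp)).neg
    rwa [show -((-1 : ℂ) • E - A) = A + E by module] at this
  have hdet := (isUnit_iff_isUnit_det _).mp hAE
  intro μ hμ
  by_contra! hn
  refine hμ ?_
  rw [spectrum.mem_resolventSet_iff, Algebra.algebraMap_eq_smul_one]
  have key : (A + E) * (μ • (1 : Matrix ι ι ℂ) - (A + E)⁻¹ * (A - E)) =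
      (1 + μ) • E - (1 - μ) • A := by
    rw [mul_sub, mul_nonsing_inv_cancel_left _ _ hdet, mul_smul_comm, mul_one]
    module
  have hunit : IsUnit ((1 + μ) • E - (1 - μ) • A) := by
    by_cases h1 : μ = 1
    · have hE0 : (1 + μ) • E - (1 - μ) • A = (2 : ℂ) • E := by subst h1; module
      rw [hE0]
      simpa using hE.smul (Units.mk0 (2 : ℂ) two_ne_zero)
    · have h1' : (1 - μ) ≠ 0 := sub_ne_zero.mpr (Ne.symm h1)
      have hre : ((1 + μ) / (1 - μ)).re ≤ 0 := by
        rw [Complex.div_re, ← add_div]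
        refine div_nonpos_of_nonpos_of_nonneg ?_ (Complex.normSq_nonneg _)
        have : 1 ≤ ‖μ‖ ^ 2 := one_le_pow₀ hn
        rw [← Complex.normSq_eq_norm_sq, Complex.normSq_apply] at this
        simp
        nlinarith
      have := (hEA _ hre).smul (Units.mk0 _ h1')
      rwa [Units.smul_mk0, smul_sub, smul_smul, mul_div_cancel₀ _ h1'] at this
  rw [← key] at hunit
  exact isUnit_of_mul_isUnit_right hunit

/-- Solutions of the generalized Lyapunov equation of an antistable pencil are negative
semidefinite. -/
theorem posSemidef_neg_of_lyapunov [DecidableEq ι] {E A X G : Matrix ι ι ℂ} (hE : IsUnit E)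
    (hEA : ∀ s : ℂ, s.re ≤ 0 → IsUnit (s • E - A)) (hX : X.IsHermitian) (hG : G.PosSemidef)
    (h : A * X * Eᴴ + E * X * Aᴴ + G = 0) : (-X).PosSemidef := by
  have hdet : IsUnit (A + E).det := by
    have := (hEA (-1) (by simp)).neg
    rw [show -((-1 : ℂ) • E - A) = A + E by module] at this
    exact (isUnit_iff_isUnit_det _).mp this
  refine posSemidef_of_sub_mul_mul_conjTranspose
    (norm_lt_one_of_mem_spectrum_cayley hE hEA) hX.neg ?_
  have hG' := (hG.add hG).mul_mul_conjTranspose_same (A + E)⁻¹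
  convert hG' using 1
  set J := (A + E)⁻¹
  have hJ : J * (A + E) = 1 := nonsing_inv_mul _ hdet
  have hJ' : (A + E)ᴴ * Jᴴ = 1 := by rw [← conjTranspose_mul, hJ, conjTranspose_one]
  have hX1 : -X = J * ((A + E) * (-X) * (A + E)ᴴ) * Jᴴ := by
    calc -X = (J * (A + E)) * (-X) * ((A + E)ᴴ * Jᴴ) := by rw [hJ, hJ', one_mul, mul_one]
      _ = _ := by noncomm_ring
  have hGG : G = -(A * X * Eᴴ + E * X * Aᴴ) := eq_neg_of_add_eq_zero_right h
  conv_lhs => enter [1]; rw [hX1]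
  rw [hGG, conjTranspose_mul, conjTranspose_add, conjTranspose_sub]
  noncomm_ring

theorem star_dotProduct_conjTranspose_mulVec (M : Matrix ι ι ℂ) (x : ι → ℂ) :
    star x ⬝ᵥ Mᴴ *ᵥ x = star (star x ⬝ᵥ M *ᵥ x) := by
  rw [star_dotProduct, star_mulVec, conjTranspose_conjTranspose, ← dotProduct_mulVec]

/-- If the Hermitian part of `T` is the opposite of a sum of positive semidefinite matrices and
the quadratic form of `T` is nonnegative at `x`, then both summands annihilate `x`. -/
theorem mulVec_eq_zero_of_add_conjTranspose {T P Q : Matrix ι ι ℂ} (hP : P.PosSemidef)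
    (hQ : Q.PosSemidef) (hT : T + Tᴴ = -(P + Q)) {x : ι → ℂ} (hx : 0 ≤ (star x ⬝ᵥ T *ᵥ x).re) :
    P *ᵥ x = 0 ∧ Q *ᵥ x = 0 := by
  rw [← hP.dotProduct_mulVec_zero_iff, ← hQ.dotProduct_mulVec_zero_iff]
  have hp := Complex.le_def.mp (hP.dotProduct_mulVec_nonneg x)
  have hq := Complex.le_def.mp (hQ.dotProduct_mulVec_nonneg x)
  have hsum := congrArg (fun M => (star x ⬝ᵥ M *ᵥ x).re) hT
  simp only [add_mulVec, neg_mulVec, dotProduct_add, dotProduct_neg, Complex.add_re,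
    Complex.neg_re, star_dotProduct_conjTranspose_mulVec, Complex.star_def, Complex.conj_re] at hsum
  simp only [Complex.zero_re, Complex.zero_im] at hp hq
  exact ⟨Complex.ext (by rw [Complex.zero_re]; linarith [hp.1, hq.1]) hp.2.symm,
    Complex.ext (by rw [Complex.zero_re]; linarith [hp.1, hq.1]) hq.2.symm⟩

/-- If every eigenvalue of `X * Eᴴ * Y * E` is at most `c`, where `X` is negative semidefinite,
then `E * X * Eᴴ * (Y * E * X * Eᴴ - c)` is positive semidefinite. -/
theorem posSemidef_gramian_mul [DecidableEq ι] {E X Y : Matrix ι ι ℂ}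
    (hX : (-X).PosSemidef) (hY : Y.IsHermitian) {c : ℝ} (hc : 0 ≤ c)
    (hspec : ∀ μ ∈ spectrum ℂ (X * Eᴴ * Y * E), μ.re ≤ c) :
    (E * X * Eᴴ * (Y * E * X * Eᴴ - (c : ℂ) • 1)).PosSemidef := by
  obtain ⟨L, hL⟩ := hX.exists_eq_mul_conjTranspose
  have hXL : X = -(L * Lᴴ) := by rw [← hL, neg_neg]
  set H : Matrix ι ι ℂ := Lᴴ * (-(Eᴴ * Y * E * L)) with hH
  have hHh : H.IsHermitian := by
    simp [IsHermitian, hH, conjTranspose_mul, hY.eq, mul_assoc]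
  have hcH : ((c : ℂ) • 1 - H).IsHermitian := by
    refine IsHermitian.sub ?_ hHh
    simp [IsHermitian]
  have hpos : ((c : ℂ) • 1 - H).PosSemidef := by
    rw [hcH.posSemidef_iff_eigenvalues_nonneg]
    intro i
    by_contra! hlt
    rw [Pi.zero_apply] at hlt
    set e := hcH.eigenvalues i with he
    have hi : (e : ℂ) ∈ spectrum ℂ ((c : ℂ) • 1 - H) := by
      rw [hcH.spectrum_eq_image_range]
      exact ⟨e, ⟨i, rfl⟩, rfl⟩
    have hmem : ((c - e : ℝ) : ℂ) ∈ spectrum ℂ H := by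
      rw [spectrum.mem_iff] at hi ⊢
      rw [← IsUnit.neg_iff] at hi
      convert hi using 2
      rw [Algebra.algebraMap_eq_smul_one, Algebra.algebraMap_eq_smul_one]
      push_cast
      module
    have hne : ((c - e : ℝ) : ℂ) ∉ ({0} : Set ℂ) := by
      rw [Set.mem_singleton_iff, Complex.ofReal_eq_zero]
      linarith
    have hmem₁ := (spectrum.nonzero_mul_comm _ _).subset ⟨hmem, hne⟩
    rw [show -(Eᴴ * Y * E * L) * Lᴴ = (Eᴴ * Y * E) * X by
      rw [hXL]; noncomm_ring, spectrum.nonzero_mul_comm, ← mul_assoc, ← mul_assoc] at hmem₁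
    have := hspec _ hmem₁.1
    rw [Complex.ofReal_re] at this
    linarith
  have := hpos.mul_mul_conjTranspose_same (E * L)
  convert this using 1
  rw [hH, hXL, conjTranspose_mul]
  simp only [mul_sub, sub_mul, mul_smul_comm, smul_mul_assoc, mul_one]
  simp only [mul_neg, neg_mul, mul_assoc, neg_neg, smul_neg]
  abel

/-- A regular pencil of the Hankel-norm approximation type attached to an antistable system
has no generalized eigenvalue in the closed right half plane. -/
theorem isUnit_pencil_of_regular [DecidableEq ι] {E A X Y G H : Matrix ι ι ℂ} (hE : IsUnit E)
    (hEA : ∀ s : ℂ, s.re ≤ 0 → IsUnit (s • E - A)) (hX : X.IsHermitian) (hY : Y.IsHermitian)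
    (hG : G.PosSemidef) (hH : H.PosSemidef)
    (hXG : A * X * Eᴴ + E * X * Aᴴ + G = 0) (hYH : Aᴴ * Y * E + Eᴴ * Y * A + H = 0)
    {γ : ℝ} (hγ : ((γ : ℂ) ^ 2) ∈ spectrum ℂ (X * Eᴴ * Y * E))
    (hspec : ∀ μ ∈ spectrum ℂ (X * Eᴴ * Y * E), μ.re ≤ γ ^ 2)
    {R N : Matrix ι ι ℂ} (hR : R = Y * E * X * Eᴴ - ((γ : ℂ) ^ 2) • 1)
    (hN : N = -(Aᴴ * R) - H * (X * Eᴴ)) {t : ℂ} (ht : (t • (Eᴴ * R) - N).det ≠ 0)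
    {s : ℂ} (hs : 0 ≤ s.re) : IsUnit (s • (Eᴴ * R) - N) := by
  have hHeq : H = -(Aᴴ * Y * E + Eᴴ * Y * A) := eq_neg_of_add_eq_zero_right hYH
  have hGeq : G = -(A * X * Eᴴ + E * X * Aᴴ) := eq_neg_of_add_eq_zero_right hXG
  have hN' : N = ((γ : ℂ) ^ 2) • Aᴴ + Eᴴ * Y * A * X * Eᴴ := by
    rw [hN, hR, hHeq, mul_sub, mul_smul_comm, mul_one]
    noncomm_ring
  have hγ0 : γ ≠ 0 := by
    rintro rfl
    simp only [Complex.ofReal_zero, ne_eq, OfNat.ofNat_ne_zero, not_false_eq_true, zero_pow,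
      zero_smul, sub_zero, zero_add] at hγ hR hN'
    rw [spectrum.zero_mem_iff, isUnit_iff_isUnit_det, isUnit_iff_ne_zero] at hγ
    refine hγ ?_
    have hfac : t • (Eᴴ * R) - N = Eᴴ * Y * (t • E - A) * X * Eᴴ := by
      rw [hR, hN']
      simp only [mul_sub, sub_mul, mul_smul_comm, smul_mul_assoc, mul_assoc]
    rw [hfac] at ht
    have hEd : E.det ≠ 0 := ((isUnit_iff_isUnit_det _).mp hE).ne_zero
    simp only [det_mul, ne_eq, mul_eq_zero, not_or] at ht ⊢
    tauto
  rw [isUnit_iff_isUnit_det, isUnit_iff_ne_zero]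
  intro hdet
  obtain ⟨x, hx0, hx⟩ := exists_mulVec_eq_zero_iff.mpr hdet
  rw [sub_mulVec, smul_mulVec, sub_eq_zero] at hx
  have hW : (E * X * Eᴴ * R).PosSemidef := by
    have := posSemidef_gramian_mul (E := E) (posSemidef_neg_of_lyapunov hE hEA hX hG hXG) hY
      (sq_nonneg γ) hspec
    rw [hR]
    simpa using this
  set T := E * X * N with hT
  set V := X * Eᴴ with hV
  have hTT : T + Tᴴ = -(((γ : ℂ) ^ 2) • G + Vᴴ * H * V) := by
    rw [hT, hN', hHeq, hGeq, hV]
    simp only [conjTranspose_mul, conjTranspose_add, conjTranspose_smul, hX.eq, hY.eq,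
      conjTranspose_conjTranspose, star_pow, Complex.star_def, Complex.conj_ofReal]
    simp only [mul_add, add_mul, mul_neg, neg_mul, mul_smul_comm, smul_mul_assoc, mul_assoc,
      smul_add, smul_neg]
    abel
  have hZG : (((γ : ℂ) ^ 2) • G).PosSemidef := by
    refine hG.smul ?_
    exact_mod_cast sq_nonneg γ
  have hZH : (Vᴴ * H * V).PosSemidef := hH.conjTranspose_mul_mul_same V
  have hTx : T *ᵥ x = s • ((E * X * Eᴴ * R) *ᵥ x) := by
    rw [hT, ← mulVec_mulVec, ← hx, mulVec_smul, mulVec_mulVec]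
    simp only [mul_assoc]
  have hqT : 0 ≤ (star x ⬝ᵥ T *ᵥ x).re := by
    have hw := Complex.le_def.mp (hW.dotProduct_mulVec_nonneg x)
    rw [hTx, dotProduct_smul, smul_eq_mul, Complex.mul_re, ← hw.2]
    simpa using mul_nonneg hs hw.1
  obtain ⟨hG0, hH0⟩ := mulVec_eq_zero_of_add_conjTranspose hZG hZH hTT hqT
  have hH0' : H *ᵥ (V *ᵥ x) = 0 := by
    rw [← hH.dotProduct_mulVec_zero_iff, star_mulVec, ← dotProduct_mulVec, mulVec_mulVec,
      mulVec_mulVec, hH0, dotProduct_zero]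
  have hG0' : G *ᵥ x = 0 := by
    rw [smul_mulVec] at hG0
    exact (smul_eq_zero.mp hG0).resolve_left (by exact_mod_cast pow_ne_zero 2 hγ0)
  have hN1 : N *ᵥ x = -(Aᴴ *ᵥ (R *ᵥ x)) := by
    rw [hN, sub_mulVec, neg_mulVec, ← mulVec_mulVec, ← mulVec_mulVec, hH0', sub_zero]
  have hRx : R *ᵥ x = 0 := by
    have hu : IsUnit (s • Eᴴ + Aᴴ) := by
      have := (hEA (-star s) (by simpa using hs)).neg.star
      rw [star_eq_conjTranspose] at this
      convert this using 1
      simp [add_comm]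
    have h0 : (s • Eᴴ + Aᴴ) *ᵥ (R *ᵥ x) = 0 := by
      rw [add_mulVec, smul_mulVec, mulVec_mulVec _ Eᴴ, hx, hN1, neg_add_cancel]
    exact mulVec_injective_of_isUnit hu (by rw [h0, mulVec_zero])
  refine ht (exists_mulVec_eq_zero_iff.mp ⟨x, hx0, ?_⟩)
  rw [sub_mulVec, smul_mulVec, ← mulVec_mulVec, hN1, hRx]
  simp

end Matrix

section Complexification

variable {ι κ τ : Type*}

theorem cplx_mul [Fintype κ] (M : Matrix ι κ ℝ) (N : Matrix κ τ ℝ) :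
    cplx (M * N) = cplx M * cplx N :=
  Matrix.map_mul (f := Complex.ofRealHom)

theorem cplx_add (M N : Matrix ι κ ℝ) : cplx (M + N) = cplx M + cplx N :=
  Matrix.map_add _ Complex.ofReal_add M N

theorem cplx_sub (M N : Matrix ι κ ℝ) : cplx (M - N) = cplx M - cplx N :=
  Matrix.map_sub _ Complex.ofReal_sub M N

theorem cplx_neg (M : Matrix ι κ ℝ) : cplx (-M) = -cplx M := by
  ext; simp [cplx]

theorem cplx_smul (c : ℝ) (M : Matrix ι κ ℝ) : cplx (c • M) = (c : ℂ) • cplx M := by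
  ext; simp [cplx]

theorem cplx_zero : cplx (0 : Matrix ι κ ℝ) = 0 := by
  ext; simp [cplx]

theorem cplx_one [DecidableEq ι] : cplx (1 : Matrix ι ι ℝ) = 1 :=
  Matrix.map_one _ Complex.ofReal_zero Complex.ofReal_one

theorem cplx_transpose (M : Matrix ι κ ℝ) : cplx Mᵀ = (cplx M)ᴴ := by
  ext; simp [cplx]

theorem isUnit_cplx_iff [Fintype ι] [DecidableEq ι] {M : Matrix ι ι ℝ} :
    IsUnit (cplx M) ↔ IsUnit M := by
  have hdet : (cplx M).det = (M.det : ℂ) := (RingHom.map_det Complex.ofRealHom M).symm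
  rw [isUnit_iff_isUnit_det, isUnit_iff_isUnit_det, hdet, isUnit_iff_ne_zero, isUnit_iff_ne_zero,
    Complex.ofReal_ne_zero]

end Complexification

section HankelPencil

open scoped ComplexOrder

variable {ι κm κp : Type*} [Fintype ι] [Fintype κm] [Fintype κp] [DecidableEq ι]

theorem RegularPair.stablePair_of_isLargestHSV
    {E A : Matrix ι ι ℝ} {B : Matrix ι κm ℝ} {C : Matrix κp ι ℝ} {Xc Xo : Matrix ι ι ℝ} {σ : ℝ}
    (hanti : AntistablePair E A) (hX : IsGramians E A B C Xc Xo) (hσ : IsLargestHSV E Xc Xo σ)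
    (hreg : RegularPair (Eg E Xc Xo σ) (Ag E A C Xc Xo σ)) :
    StablePair (Eg E Xc Xo σ) (Ag E A C Xc Xo σ) := by
  obtain ⟨hE, hEA⟩ := hanti
  obtain ⟨hXc, hXo, hc, ho⟩ := hX
  obtain ⟨-, hmem, hle⟩ := hσ
  obtain ⟨t, ht⟩ := hreg
  intro s hs
  replace hc := congrArg cplx hc
  replace ho := congrArg cplx ho
  simp only [cplx_add, cplx_mul, cplx_transpose, cplx_zero] at hc ho hmem hle
  have hEg : cplx (Eg E Xc Xo σ) = (cplx E)ᴴ * cplx (Rg E Xc Xo σ) := by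
    rw [Eg, cplx_mul, cplx_transpose]
  rw [hEg] at ht ⊢
  refine Matrix.isUnit_pencil_of_regular (isUnit_cplx_iff.mpr hE) hEA ?_ ?_
    (Matrix.posSemidef_self_mul_conjTranspose (cplx B))
    (Matrix.posSemidef_conjTranspose_mul_self (cplx C)) hc ho hmem hle ?_ ?_ ht hs
  · rw [Matrix.IsHermitian, ← cplx_transpose, hXc.eq]
  · rw [Matrix.IsHermitian, ← cplx_transpose, hXo.eq]
  · simp only [Rg, cplx_sub, cplx_mul, cplx_smul, cplx_one, cplx_transpose, Complex.ofReal_pow]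
  · simp only [Ag, Cg, cplx_sub, cplx_neg, cplx_mul, cplx_transpose, Matrix.mul_assoc]

theorem StablePair.isUnit {E A : Matrix ι ι ℝ} (h : StablePair E A) : IsUnit A := by
  simpa [isUnit_cplx_iff] using h 0 le_rfl

theorem RegularPair.of_isUnit {E A : Matrix ι ι ℝ} (h : IsUnit A) : RegularPair E A := by
  refine ⟨0, ?_⟩
  rw [zero_smul, zero_sub, ← isUnit_iff_ne_zero, ← isUnit_iff_isUnit_det, IsUnit.neg_iff]
  exact isUnit_cplx_iff.mpr h

end HankelPencil

noncomputable section

theorem stmt11 {n m p : ℕ}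
    (E A : Matrix (Fin n) (Fin n) ℝ) (B : Matrix (Fin n) (Fin m) ℝ)
    (C : Matrix (Fin p) (Fin n) ℝ) (D : Matrix (Fin p) (Fin m) ℝ)
    (hanti : AntistablePair E A)
    (Xc Xo : Matrix (Fin n) (Fin n) ℝ) (hX : IsGramians E A B C Xc Xo)
    (σ1 : ℝ) (hσ : IsLargestHSV E Xc Xo σ1) :
    (RegularPair (Eg E Xc Xo σ1) (Ag E A C Xc Xo σ1) ↔
      StablePair (Eg E Xc Xo σ1) (Ag E A C Xc Xo σ1)) ∧
    (StablePair (Eg E Xc Xo σ1) (Ag E A C Xc Xo σ1) ↔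
      IsUnit (Ag E A C Xc Xo σ1)) := by
  have hreg := RegularPair.stablePair_of_isLargestHSV hanti hX hσ
  exact ⟨⟨hreg, fun h => .of_isUnit h.isUnit⟩, ⟨fun h => h.isUnit, fun h => hreg (.of_isUnit h)⟩⟩

end
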